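/- Let a(n) be the number of Dyck paths of semi-length n with no maximal ascending run of length 2 and no maximal descending run of length 3, and let P = \sum_{n\ge 0} a(n) x^n in the ring of formal power series over the integers. Then 1 - (x+1)(x^2-x+1) P + x(x^3+x^2-x+1) P^2 + x^4(x^5-x^3+2x^2-1) P^3 + x^4(x^6-3x^5+x^4-x+1) P^4 + x^6(x^7+2x^4+x^3+x^2+1) P^5 + x^9(2x^6+x^5+2x^3+3x^2-x+1) P^6 + x^{11}(x^6+2x^5+x^3+3x^2-2x+1) P^7 + x^{15}(x^4+x^3+x^2+1) P^8 + x^{18}(x^3+x^2+1) P^9 + x^{22} P^{10} = 0. -/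

import Mathlib

open Finset PowerSeries

/-- A word over the step alphabet (`true` = U = (1,1), `false` = D = (1,-1)) is a
Dyck path if it has equally many U's and D's and every prefix has at least as
many U's as D's (i.e. the lattice path never goes below the x-axis). -/
def IsDyck (w : List Bool) : Prop :=
  w.count true = w.count false ∧
    ∀ k, (w.take k).count false ≤ (w.take k).count true
/-- The word `w` has a maximal ascending run (maximal block of consecutive U-steps)
starting at position `i` and of length `l`. -/
def AscRun (w : List Bool) (i l : ℕ) : Prop :=
  1 ≤ l ∧ (∀ j < l, w[i + j]? = some true) ∧
    (∀ i', i = i' + 1 → w[i']? = some false) ∧ w[i + l]? ≠ some true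

/-- The word `w` has a maximal descending run (maximal block of consecutive D-steps)
starting at position `i` and of length `l`. -/
def DescRun (w : List Bool) (i l : ℕ) : Prop :=
  1 ≤ l ∧ (∀ j < l, w[i + j]? = some false) ∧
    (∀ i', i = i' + 1 → w[i']? = some true) ∧ w[i + l]? ≠ some false

/-- `runsAvoid b m k w`: in the word `b ^ k w`, no maximal run of `b` that is either the
(possibly empty) initial one or preceded by another letter has length `m`. -/
def runsAvoid (b : Bool) (m : ℕ) : ℕ → List Bool → Bool
  | k, [] => decide (k ≠ m)
  | k, c :: w => if c = b then runsAvoid b m (k + 1) w else decide (k ≠ m) && runsAvoid b m 0 w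

theorem runsAvoid_iff (b : Bool) (m k : ℕ) (w : List Bool) :
    runsAvoid b m k w = true ↔
      (∀ l, (∀ j < l, w[j]? = some b) → w[l]? ≠ some b → k + l ≠ m) ∧
      (∀ i l, w[i]? = some (!b) → (∀ j < l, w[i + 1 + j]? = some b) →
        w[i + 1 + l]? ≠ some b → l ≠ m) := by
  induction w generalizing k with
  | nil =>
    simp only [runsAvoid, decide_eq_true_eq]
    constructor
    · refine fun h => ⟨fun l hl _ => ?_, by simp⟩
      cases l with
      | zero => simpa using h
      | succ l => simpa using hl 0 (by lia)
    · rintro ⟨h, -⟩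
      simpa using h 0 (by simp)
  | cons c w ih =>
    by_cases hc : c = b
    · subst hc
      simp only [runsAvoid, if_true, ih]
      constructor
      · rintro ⟨h₁, h₂⟩
        refine ⟨fun l hl hl' => ?_, fun i l hi hl hl' => ?_⟩
        · cases l with
          | zero => simp at hl'
          | succ l =>
            have := h₁ l (fun j hj => by simpa using hl (j + 1) (by lia)) (by simpa using hl')
            lia
        · cases i with
          | zero => simp at hi
          | succ i =>
            refine h₂ i l (by simpa using hi) (fun j hj => ?_) ?_
            · have := hl j hj
              rwa [show i + 1 + 1 + j = (i + 1 + j) + 1 by lia, List.getElem?_cons_succ] at this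
            · rwa [show i + 1 + 1 + l = (i + 1 + l) + 1 by lia, List.getElem?_cons_succ] at hl'
      · rintro ⟨h₁, h₂⟩
        refine ⟨fun l hl hl' => ?_, fun i l hi hl hl' => ?_⟩
        · have := h₁ (l + 1) (fun j hj => ?_) (by simpa using hl')
          · lia
          · cases j with
            | zero => simp
            | succ j => simpa using hl j (by lia)
        · refine h₂ (i + 1) l (by simpa using hi) (fun j hj => ?_) ?_
          · rw [show i + 1 + 1 + j = (i + 1 + j) + 1 by lia, List.getElem?_cons_succ]
            exact hl j hj
          · rwa [show i + 1 + 1 + l = (i + 1 + l) + 1 by lia, List.getElem?_cons_succ]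
    · obtain rfl : c = !b := by cases c <;> cases b <;> simp_all
      simp only [runsAvoid, hc, if_false, Bool.and_eq_true, decide_eq_true_eq, ih]
      constructor
      · rintro ⟨h₀, h₁, h₂⟩
        refine ⟨fun l hl hl' => ?_, fun i l hi hl hl' => ?_⟩
        · cases l with
          | zero => simpa using h₀
          | succ l => simpa using hl 0 (by lia)
        · cases i with
          | zero =>
            have := h₁ l (fun j hj => ?_) ?_
            · lia
            · have := hl j hj
              rwa [show 0 + 1 + j = j + 1 by lia, List.getElem?_cons_succ] at this
            · rwa [show 0 + 1 + l = l + 1 by lia, List.getElem?_cons_succ] at hl'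
          | succ i =>
            refine h₂ i l (by simpa using hi) (fun j hj => ?_) ?_
            · have := hl j hj
              rwa [show i + 1 + 1 + j = (i + 1 + j) + 1 by lia, List.getElem?_cons_succ] at this
            · rwa [show i + 1 + 1 + l = (i + 1 + l) + 1 by lia, List.getElem?_cons_succ] at hl'
      · rintro ⟨h₁, h₂⟩
        refine ⟨by simpa using h₁ 0 (by simp), fun l hl hl' => ?_, fun i l hi hl hl' => ?_⟩
        · have := h₂ 0 l (by simp) (fun j hj => ?_) ?_
          · lia
          · rw [show 0 + 1 + j = j + 1 by lia, List.getElem?_cons_succ]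
            exact hl j hj
          · rwa [show 0 + 1 + l = l + 1 by lia, List.getElem?_cons_succ]
        · refine h₂ (i + 1) l (by simpa using hi) (fun j hj => ?_) ?_
          · rw [show i + 1 + 1 + j = (i + 1 + j) + 1 by lia, List.getElem?_cons_succ]
            exact hl j hj
          · rwa [show i + 1 + 1 + l = (i + 1 + l) + 1 by lia, List.getElem?_cons_succ]

theorem runsAvoid_zero_iff (b : Bool) {m : ℕ} (hm : m ≠ 0) (w : List Bool) :
    runsAvoid b m 0 w = true ↔
      ∀ i l, (1 ≤ l ∧ (∀ j < l, w[i + j]? = some b) ∧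
        (∀ i', i = i' + 1 → w[i']? = some (!b)) ∧ w[i + l]? ≠ some b) → l ≠ m := by
  rw [runsAvoid_iff]
  constructor
  · rintro ⟨h₁, h₂⟩ i l ⟨-, hl, hi, hl'⟩
    cases i with
    | zero => simpa using h₁ l (by simpa using hl) (by simpa using hl')
    | succ i => exact h₂ i l (hi i rfl) hl hl'
  · intro h
    refine ⟨fun l hl hl' => ?_, fun i l hi hl hl' => ?_⟩
    · rcases Nat.eq_zero_or_pos l with rfl | hpos
      · lia
      · simpa using h 0 l ⟨hpos, by simpa using hl, by simp, by simpa using hl'⟩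
    · rcases Nat.eq_zero_or_pos l with rfl | hpos
      · exact hm.symm
      · exact h (i + 1) l ⟨hpos, hl, fun i' hi' => by rwa [← Nat.succ.inj hi'], hl'⟩

theorem runsAvoid_append_cons (b : Bool) (m k : ℕ) (u v : List Bool) :
    runsAvoid b m k (u ++ (!b) :: v) = (runsAvoid b m k u && runsAvoid b m 0 v) := by
  induction u generalizing k with
  | nil => simp [runsAvoid]
  | cons c u ih =>
    simp only [List.cons_append, runsAvoid, ih]
    split_ifs <;> simp [Bool.and_assoc]

theorem runsAvoid_replicate (b : Bool) (m k t : ℕ) :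
    runsAvoid b m k (List.replicate t b) = decide (k + t ≠ m) := by
  induction t generalizing k with
  | zero => simp [runsAvoid]
  | succ t ih =>
    simp only [List.replicate_succ, runsAvoid, if_true, ih]
    congr 2
    rw [Nat.add_right_comm, Nat.add_assoc]

theorem runsAvoid_succ_of_lt (b : Bool) {m k : ℕ} (h : m < k) (w : List Bool) :
    runsAvoid b m (k + 1) w = runsAvoid b m k w := by
  induction w generalizing k with
  | nil => simp only [runsAvoid, decide_eq_decide]; lia
  | cons c w ih =>
    simp only [runsAvoid, ih (Nat.lt_succ_of_lt h)]
    rw [show decide (k + 1 ≠ m) = decide (k ≠ m) by rw [decide_eq_decide]; lia]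

theorem runsAvoid_append_replicate_succ (b : Bool) {m t : ℕ} (h : m < t) (k : ℕ) (w : List Bool) :
    runsAvoid b m k (w ++ List.replicate (t + 1) b) =
      runsAvoid b m k (w ++ List.replicate t b) := by
  induction w generalizing k with
  | nil => simp only [List.nil_append, runsAvoid_replicate, decide_eq_decide]; lia
  | cons c w ih => simp only [List.cons_append, runsAvoid, ih]

open BinaryTree

/-- The Dyck path coded by a binary tree through the first-return decomposition. -/
def treeWord : BinaryTree Unit → List Bool
  | .nil => []
  | .node _ l r => true :: (treeWord l ++ false :: treeWord r)

/-- The path `U ^ s w`, with `w` coded by `t`, has no ascending run of length `2`. -/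
def ascOK (s : ℕ) (t : BinaryTree Unit) : Bool := runsAvoid true 2 s (treeWord t)

/-- The path `w D ^ k`, with `w` coded by `t`, has no descending run of length `3`. -/
def descOK (k : ℕ) (t : BinaryTree Unit) : Bool :=
  runsAvoid false 3 0 (treeWord t ++ List.replicate k false)

theorem ascOK_nil (s : ℕ) : ascOK s nil = decide (s ≠ 2) := rfl

theorem ascOK_node (s : ℕ) (l r : BinaryTree Unit) :
    ascOK s (l △ r) = (ascOK (s + 1) l && ascOK 0 r) :=
  runsAvoid_append_cons true 2 (s + 1) _ _

theorem descOK_nil (k : ℕ) : descOK k nil = decide (k ≠ 3) := by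
  simp [descOK, treeWord, runsAvoid_replicate]

theorem descOK_node_nil (k : ℕ) (l : BinaryTree Unit) : descOK k (l △ nil) = descOK (k + 1) l := by
  simp [descOK, treeWord, runsAvoid, List.replicate_succ]

theorem descOK_node_node (k : ℕ) (l a b : BinaryTree Unit) :
    descOK k (l △ (a △ b)) = (descOK 1 l && descOK k (a △ b)) := by
  have := runsAvoid_append_cons false 3 0 (treeWord l ++ [false])
    (treeWord a ++ false :: treeWord b ++ List.replicate k false)
  simpa [descOK, treeWord, runsAvoid] using this

theorem ascOK_succ_node {s : ℕ} (h : 2 ≤ s) (l r : BinaryTree Unit) :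
    ascOK (s + 1) (l △ r) = ascOK s (l △ r) := by
  simp only [ascOK_node]
  rw [ascOK, runsAvoid_succ_of_lt true (by lia), ← ascOK]

theorem descOK_succ_node {k : ℕ} (h : 3 ≤ k) (l r : BinaryTree Unit) :
    descOK (k + 1) (l △ r) = descOK k (l △ r) := by
  induction r generalizing l with
  | nil =>
    simp only [descOK_node_nil]
    exact runsAvoid_append_replicate_succ false (by lia) 0 _
  | node _ a b _ ih => rw [descOK_node_node, descOK_node_node, ih]

/-- The generating function of a weight on binary trees by number of nodes. -/
noncomputable def treeGF (f : BinaryTree Unit → ℤ) : PowerSeries ℤ :=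
  PowerSeries.mk fun n => ∑ t ∈ treesOfNumNodesEq n, f t

theorem treeGF_add (f g : BinaryTree Unit → ℤ) :
    treeGF (fun t => f t + g t) = treeGF f + treeGF g := by
  ext n
  simp [treeGF, Finset.sum_add_distrib]

theorem treeGF_ite_nil (c : ℤ) : treeGF (fun t => if t = nil then c else 0) = C c := by
  ext n
  simp only [treeGF, coeff_mk, Finset.sum_ite_eq', coeff_C, mem_treesOfNumNodesEq]
  simp [BinaryTree.numNodes, eq_comm]

theorem sum_treesOfNumNodesEq_succ (f : BinaryTree Unit → ℤ) (n : ℕ) :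
    ∑ t ∈ treesOfNumNodesEq (n + 1), f t =
      ∑ ij ∈ antidiagonal n, ∑ l ∈ treesOfNumNodesEq ij.1, ∑ r ∈ treesOfNumNodesEq ij.2,
        f (l △ r) := by
  rw [treesOfNumNodesEq_succ, Finset.sum_biUnion]
  · refine Finset.sum_congr rfl fun ij _ => ?_
    rw [Finset.sum_map, Finset.sum_product]
    rfl
  · simp_rw [Set.PairwiseDisjoint, Set.Pairwise, disjoint_left]
    aesop

theorem treeGF_of_node {f g₁ h₁ g₂ h₂ : BinaryTree Unit → ℤ} (h0 : f nil = 0)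
    (h : ∀ l r, f (l △ r) = g₁ l * h₁ r + g₂ l * h₂ r) :
    treeGF f = X * (treeGF g₁ * treeGF h₁ + treeGF g₂ * treeGF h₂) := by
  ext n
  cases n with
  | zero => simp [treeGF, h0]
  | succ n =>
    rw [coeff_succ_X_mul, map_add, coeff_mul, coeff_mul, ← Finset.sum_add_distrib]
    simp only [treeGF, coeff_mk, sum_treesOfNumNodesEq_succ, h, Finset.sum_add_distrib,
      Finset.sum_mul_sum]

/-- Indicator of the trees coding a word `w` such that `U ^ s w D ^ k` has only allowed runs. -/
def okWeight (s k : ℕ) (t : BinaryTree Unit) : ℤ := if ascOK s t && descOK k t then 1 else 0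

/-- The restriction of `okWeight` to nonempty trees. -/
def okWeightNode (s k : ℕ) (t : BinaryTree Unit) : ℤ := if t = nil then 0 else okWeight s k t

theorem treeGF_okWeight (s k : ℕ) :
    treeGF (okWeight s k) = C (if s ≠ 2 ∧ k ≠ 3 then 1 else 0) + treeGF (okWeightNode s k) := by
  rw [← treeGF_ite_nil, ← treeGF_add]
  congr 1
  ext t
  by_cases ht : t = nil
  · subst ht
    simp [okWeightNode, okWeight, ascOK_nil, descOK_nil]
  · simp [okWeightNode, ht]

theorem treeGF_okWeightNode (s k : ℕ) :
    treeGF (okWeightNode s k) = X * (treeGF (okWeight (s + 1) (k + 1)) +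
      treeGF (okWeight (s + 1) 1) * treeGF (okWeightNode 0 k)) := by
  have h1 : treeGF (fun t => if t = nil then (1 : ℤ) else 0) = 1 := by simp [treeGF_ite_nil]
  rw [← mul_one (treeGF (okWeight (s + 1) (k + 1))), ← h1]
  refine treeGF_of_node (by simp [okWeightNode]) fun l r => ?_
  cases r with
  | nil => simp [okWeightNode, okWeight, ascOK_node, ascOK_nil, descOK_node_nil]
  | node _ a b =>
    simp only [okWeightNode, okWeight, reduceCtorEq, if_false, mul_zero, zero_add]
    rw [ascOK_node, descOK_node_node]
    cases ascOK (s + 1) l <;> cases ascOK 0 (a △ b) <;> cases descOK 1 l <;>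
      cases descOK k (a △ b) <;> rfl

theorem okWeightNode_succ_left {s : ℕ} (h : 2 ≤ s) (k : ℕ) :
    okWeightNode (s + 1) k = okWeightNode s k := by
  ext t
  cases t with
  | nil => rfl
  | node _ l r => simp only [okWeightNode, okWeight, ascOK_succ_node h]

theorem okWeightNode_succ_right (s : ℕ) {k : ℕ} (h : 3 ≤ k) :
    okWeightNode s (k + 1) = okWeightNode s k := by
  ext t
  cases t with
  | nil => rfl
  | node _ l r => simp only [okWeightNode, okWeight, descOK_succ_node h]

theorem resultant_of_common_root {R : Type*} [CommRing R] {a f₀ f₁ f₂ g₀ g₁ g₂ : R}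
    (hf : f₂ * a ^ 2 + f₁ * a + f₀ = 0) (hg : g₂ * a ^ 2 + g₁ * a + g₀ = 0) :
    g₂ * ((f₂ * g₀ - f₀ * g₂) ^ 2 - (f₂ * g₁ - f₁ * g₂) * (f₁ * g₀ - f₀ * g₁)) = 0 := by
  have hU : (f₂ * g₁ - f₁ * g₂) * a + (f₂ * g₀ - f₀ * g₂) = 0 := by
    linear_combination f₂ * hg - g₂ * hf
  linear_combination (f₂ * g₁ - f₁ * g₂) ^ 2 * hg -
    (g₂ * ((f₂ * g₁ - f₁ * g₂) * a - (f₂ * g₀ - f₀ * g₂)) + g₁ * (f₂ * g₁ - f₁ * g₂)) * hU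

theorem algebraic_equation_of_system {R : Type*} [CommRing R] [IsDomain R]
    {x P n01 n02 n03 n11 n12 n13 a b d : R} (hx : x ≠ 0) (hP : P ≠ 0)
    (h00 : P - 1 = x * (1 + n11) * P)
    (h01 : n01 = x * (1 + n12 + (1 + n11) * n01))
    (h02 : n02 = x * (n13 + (1 + n11) * n02))
    (h03 : n03 = x * (1 + n13 + (1 + n11) * n03))
    (h11 : n11 = x * (b + a * n01))
    (h12 : n12 = x * (d + a * n02))
    (h13 : n13 = x * (d + a * n03))
    (h21 : a = x * (1 + b + (1 + a) * n01))
    (h22 : b = x * (d + (1 + a) * n02))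
    (h23 : d = x * (1 + d + (1 + a) * n03)) :
    1 - (x + 1) * (x ^ 2 - x + 1) * P
      + x * (x ^ 3 + x ^ 2 - x + 1) * P ^ 2
      + x ^ 4 * (x ^ 5 - x ^ 3 + 2 * x ^ 2 - 1) * P ^ 3
      + x ^ 4 * (x ^ 6 - 3 * x ^ 5 + x ^ 4 - x + 1) * P ^ 4
      + x ^ 6 * (x ^ 7 + 2 * x ^ 4 + x ^ 3 + x ^ 2 + 1) * P ^ 5
      + x ^ 9 * (2 * x ^ 6 + x ^ 5 + 2 * x ^ 3 + 3 * x ^ 2 - x + 1) * P ^ 6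
      + x ^ 11 * (x ^ 6 + 2 * x ^ 5 + x ^ 3 + 3 * x ^ 2 - 2 * x + 1) * P ^ 7
      + x ^ 15 * (x ^ 4 + x ^ 3 + x ^ 2 + 1) * P ^ 8
      + x ^ 18 * (x ^ 3 + x ^ 2 + 1) * P ^ 9
      + x ^ 22 * P ^ 10 = 0 := by
  obtain ⟨q, rfl⟩ : ∃ q, n13 = q - 1 := ⟨n13 + 1, by ring⟩
  have e01 : n01 = x * P * (1 + n12) := by linear_combination P * h01 - n01 * h00
  have e02 : n02 = x * P * (q - 1) := by linear_combination P * h02 - n02 * h00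
  have e03 : n03 = x * P * q := by linear_combination P * h03 - n03 * h00
  have e11 : n11 = a - x - x * n01 := by linear_combination h11 - h21
  have e12 : n12 = b - x * n02 := by linear_combination h12 - h22
  have ed : d = q * (1 + x * (x * P)) - 1 + x := by linear_combination h23 - h13 + x * e03
  subst e03 e02 e12 ed
  have hq : q * ((1 - x) * (1 + x * (x * P)) - x * (x * P) * (1 + a)) = 1 - x + x ^ 2 := by
    linear_combination h23
  have eb : b = (1 + x * (x * P)) * q - 1 - x * (x * P) * (1 + a) := by
    linear_combination h22 - hq
  subst eb
  have f01 : n01 = x * P * (q - x * (x * P) * a) := by linear_combination e01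
  subst f01 e11
  have hL : x ^ 3 * P ^ 2 * q = (P * x + x ^ 5 * P ^ 3) * a + (1 - P + P * x * (1 - x)) := by
    linear_combination h00
  have hq' : (1 + x * (x * P)) * q = a + x * (x * P) * x * (1 + a) + (1 - x + x ^ 2)
      + x ^ 2 * (x * P) ^ 2 * (1 + a) * a := by
    linear_combination -h21 + hq
  have hf : (-x ^ 3 * P ^ 2 - x ^ 7 * P ^ 4) * a ^ 2
      + (x * P - 2 * x ^ 2 * P + x ^ 2 * P ^ 2 - x ^ 3 * P ^ 2 + x ^ 5 * P ^ 3 - x ^ 6 * P ^ 3 - x ^ 8 * P ^ 4) * a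
      + (1 - x - P + 2 * x * P - 2 * x ^ 2 * P) = 0 := by
    linear_combination x ^ 3 * P ^ 2 * hq - ((1 - x) * (1 + x * (x * P)) - x * (x * P) * (1 + a)) * hL
  have hg : (-x ^ 7 * P ^ 4) * a ^ 2
      + (x * P + x ^ 5 * P ^ 3 - x ^ 6 * P ^ 3) * a
      + (1 - P + x * P - x ^ 2 * P ^ 2 - x ^ 5 * P ^ 2 - x ^ 6 * P ^ 3) = 0 := by
    linear_combination x ^ 3 * P ^ 2 * hq' - (1 + x * (x * P)) * hL
  have hres := resultant_of_common_root hf hg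
  have hxP : -(x ^ 14 * P ^ 9) ≠ 0 :=
    neg_ne_zero.mpr (mul_ne_zero (pow_ne_zero _ hx) (pow_ne_zero _ hP))
  refine (mul_eq_zero.mp ?_).resolve_left hxP
  linear_combination hres

/-- The Boolean encoding of a step, with `true` for an up-step. -/
def stepEquivBool : DyckStep ≃ Bool where
  toFun s := decide (s = .U)
  invFun b := if b then .U else .D
  left_inv s := by cases s <;> rfl
  right_inv b := by cases b <;> rfl

theorem map_toList_ofTree (t : BinaryTree Unit) :
    (DyckWord.ofTree t).toList.map stepEquivBool = treeWord t := by
  induction t with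
  | nil => rfl
  | node _ l r ihl ihr =>
    change ((DyckStep.U :: (DyckWord.ofTree l).toList ++ [DyckStep.D]) ++
      (DyckWord.ofTree r).toList).map stepEquivBool = _
    simp only [List.map_append, List.map_cons, List.map_nil, ihl, ihr]
    simp [treeWord, stepEquivBool]

theorem treeWord_injective : Function.Injective treeWord := by
  intro s t h
  rw [← map_toList_ofTree, ← map_toList_ofTree] at h
  exact DyckWord.equivTree.symm.injective
    (DyckWord.ext (List.map_injective_iff.mpr stepEquivBool.injective h))

theorem count_map_stepEquivBool (w : List DyckStep) (s : DyckStep) :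
    (w.map stepEquivBool).count (stepEquivBool s) = w.count s :=
  List.count_map_of_injective w _ stepEquivBool.injective s

theorem isDyck_map_stepEquivBool (w : List DyckStep) :
    IsDyck (w.map stepEquivBool) ↔
      w.count .U = w.count .D ∧ ∀ i, (w.take i).count .D ≤ (w.take i).count .U := by
  simp only [IsDyck, ← List.map_take]
  rw [← count_map_stepEquivBool w .U, ← count_map_stepEquivBool w .D]
  refine and_congr Iff.rfl (forall_congr' fun i => ?_)
  rw [← count_map_stepEquivBool _ .U, ← count_map_stepEquivBool _ .D]
  rfl

theorem isDyck_treeWord (t : BinaryTree Unit) : IsDyck (treeWord t) := by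
  rw [← map_toList_ofTree, isDyck_map_stepEquivBool]
  exact ⟨DyckWord.count_U_eq_count_D _, DyckWord.count_D_le_count_U _⟩

theorem IsDyck.exists_treeWord_eq {w : List Bool} (h : IsDyck w) : ∃ t, treeWord t = w := by
  obtain ⟨v, rfl⟩ : ∃ v : List DyckStep, v.map stepEquivBool = w :=
    ⟨w.map stepEquivBool.symm, by simp⟩
  rw [isDyck_map_stepEquivBool] at h
  exact ⟨DyckWord.toTree ⟨v, h.1, h.2⟩, by rw [← map_toList_ofTree, DyckWord.ofTree_toTree]⟩

theorem count_true_treeWord (t : BinaryTree Unit) : (treeWord t).count true = t.numNodes := by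
  induction t with
  | nil => rfl
  | node _ l r ihl ihr => simp [treeWord, BinaryTree.numNodes, ihl, ihr]

theorem ascOK_zero_iff (t : BinaryTree Unit) :
    ascOK 0 t = true ↔ ∀ i l, AscRun (treeWord t) i l → l ≠ 2 :=
  runsAvoid_zero_iff true two_ne_zero _

theorem descOK_zero_iff (t : BinaryTree Unit) :
    descOK 0 t = true ↔ ∀ i l, DescRun (treeWord t) i l → l ≠ 3 := by
  rw [descOK, List.replicate_zero, List.append_nil]
  exact runsAvoid_zero_iff false three_ne_zero _

theorem card_restricted_dyck (n : ℕ) :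
    Nat.card {w : List Bool // IsDyck w ∧ w.count true = n ∧
      (∀ i l, AscRun w i l → l ≠ 2) ∧ (∀ i l, DescRun w i l → l ≠ 3)} =
    #{t ∈ treesOfNumNodesEq n | ascOK 0 t && descOK 0 t} := by
  rw [← Finset.card_image_of_injective _ treeWord_injective]
  refine Nat.subtype_card _ fun w => ?_
  simp only [Finset.mem_image, Finset.mem_filter, mem_treesOfNumNodesEq, Bool.and_eq_true,
    ascOK_zero_iff, descOK_zero_iff]
  constructor
  · rintro ⟨t, ⟨rfl, h⟩, rfl⟩
    exact ⟨isDyck_treeWord t, count_true_treeWord t, h⟩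
  · rintro ⟨hw, rfl, h⟩
    obtain ⟨t, rfl⟩ := hw.exists_treeWord_eq
    exact ⟨t, ⟨(count_true_treeWord t).symm, h⟩, rfl⟩

/-- If `a n` counts Dyck paths of semi-length `n` with no maximal ascending run
of length `2` and no maximal descending run of length `3`, then `P = ∑ a(n) xⁿ`
over `ℤ` satisfies the stated degree-10 algebraic equation. -/
theorem statement14 (a : ℕ → ℕ)
    (ha : ∀ n, a n = Nat.card {w : List Bool // IsDyck w ∧ w.count true = n ∧
      (∀ i l, AscRun w i l → l ≠ 2) ∧ (∀ i l, DescRun w i l → l ≠ 3)})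
    (P : PowerSeries ℤ) (hP : P = PowerSeries.mk fun n => (a n : ℤ)) :
    1 - (X + 1) * (X ^ 2 - X + 1) * P
      + X * (X ^ 3 + X ^ 2 - X + 1) * P ^ 2
      + X ^ 4 * (X ^ 5 - X ^ 3 + 2 * X ^ 2 - 1) * P ^ 3
      + X ^ 4 * (X ^ 6 - 3 * X ^ 5 + X ^ 4 - X + 1) * P ^ 4
      + X ^ 6 * (X ^ 7 + 2 * X ^ 4 + X ^ 3 + X ^ 2 + 1) * P ^ 5
      + X ^ 9 * (2 * X ^ 6 + X ^ 5 + 2 * X ^ 3 + 3 * X ^ 2 - X + 1) * P ^ 6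
      + X ^ 11 * (X ^ 6 + 2 * X ^ 5 + X ^ 3 + 3 * X ^ 2 - 2 * X + 1) * P ^ 7
      + X ^ 15 * (X ^ 4 + X ^ 3 + X ^ 2 + 1) * P ^ 8
      + X ^ 18 * (X ^ 3 + X ^ 2 + 1) * P ^ 9
      + X ^ 22 * P ^ 10 = 0 := by
  have hPM : P = treeGF (okWeight 0 0) := by
    ext n
    simp [hP, ha, card_restricted_dyck, treeGF, okWeight]
  have hM (s k : ℕ) : treeGF (okWeight s k) =
      (if s ≠ 2 ∧ k ≠ 3 then 1 else 0) + treeGF (okWeightNode s k) := by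
    rw [treeGF_okWeight]
    split_ifs <;> simp
  have hP0 : P ≠ 0 := by
    intro h
    have := congrArg (PowerSeries.coeff 0) (hPM.symm.trans h)
    simp [treeGF, okWeight, ascOK_nil, descOK_nil] at this
  have hl (k : ℕ) : okWeightNode 3 k = okWeightNode 2 k := okWeightNode_succ_left le_rfl k
  have hr (s : ℕ) : okWeightNode s 4 = okWeightNode s 3 := okWeightNode_succ_right s le_rfl
  have hN (s k : ℕ) := treeGF_okWeightNode s k
  have h00 : P = 1 + treeGF (okWeightNode 0 0) := by simpa [hM] using hPM
  refine algebraic_equation_of_system X_ne_zero hP0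
    (n01 := treeGF (okWeightNode 0 1)) (n02 := treeGF (okWeightNode 0 2))
    (n03 := treeGF (okWeightNode 0 3)) (n11 := treeGF (okWeightNode 1 1))
    (n12 := treeGF (okWeightNode 1 2)) (n13 := treeGF (okWeightNode 1 3))
    (a := treeGF (okWeightNode 2 1)) (b := treeGF (okWeightNode 2 2))
    (d := treeGF (okWeightNode 2 3)) ?_ ?_ ?_ ?_ ?_ ?_ ?_ ?_ ?_ ?_
  · have := hN 0 0
    simp [hM] at this
    linear_combination (1 - X * (1 + treeGF (okWeightNode 1 1))) * h00 + this
  · simpa [hM] using hN 0 1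
  · simpa [hM] using hN 0 2
  · simpa [hM, hr] using hN 0 3
  · simpa [hM] using hN 1 1
  · simpa [hM] using hN 1 2
  · simpa [hM, hr] using hN 1 3
  · simpa [hM, hl] using hN 2 1
  · simpa [hM, hl] using hN 2 2
  · simpa [hM, hl, hr] using hN 2 3
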